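/- arXiv:2406.01992 — 3 statements merged into one kernel-verified Lean document; each statement's English description precedes it below -/
import Mathlib

section
/- Assume F is bounded below on X × Y by a constant F̲, and assume there exists a point (x̄,ȳ,z̄) ∈ X × Y × Z with G_γ(x̄,ȳ,z̄) = 0. Then for every ε > 0 there exists c̄ > 0 such that for every c ≥ c̄, every global minimizer (x_c,y_c,z_c) of (x,y,z) ↦ F(x,y) + c·G_γ(x,y,z) over X × Y × Z satisfies ε_c := G_γ(x_c,y_c,z_c) ≤ ε, and (x_c,y_c,z_c) is a global minimizer of (x,y,z) ↦ F(x,y) over the relaxed feasible set {(x,y,z) ∈ X × Y × Z : G_γ(x,y,z) ≤ ε_c}. -/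
/-- The Lagrangian `L(x,y,z) = f(x,y) + zᵀ g(x,y)` of the lower-level problem. -/
noncomputable def lagr {n m p : ℕ}
    (f : EuclideanSpace ℝ (Fin n) → EuclideanSpace ℝ (Fin m) → ℝ)
    (g : EuclideanSpace ℝ (Fin n) → EuclideanSpace ℝ (Fin m) → EuclideanSpace ℝ (Fin p))
    (x : EuclideanSpace ℝ (Fin n)) (y : EuclideanSpace ℝ (Fin m))
    (z : EuclideanSpace ℝ (Fin p)) : ℝ :=
  f x y + ∑ i, z i * g x y i

/-- The doubly regularized gap function
`G_γ(x,y,z) = sup_{θ ∈ Y, λ ≥ 0} [L(x,y,λ) − ‖λ−z‖²/(2γ₂) − L(x,θ,z) − ‖θ−y‖²/(2γ₁)]`. -/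
noncomputable def gapG {n m p : ℕ}
    (f : EuclideanSpace ℝ (Fin n) → EuclideanSpace ℝ (Fin m) → ℝ)
    (g : EuclideanSpace ℝ (Fin n) → EuclideanSpace ℝ (Fin m) → EuclideanSpace ℝ (Fin p))
    (Y : Set (EuclideanSpace ℝ (Fin m))) (γ1 γ2 : ℝ)
    (x : EuclideanSpace ℝ (Fin n)) (y : EuclideanSpace ℝ (Fin m))
    (z : EuclideanSpace ℝ (Fin p)) : ℝ :=
  sSup { v : ℝ | ∃ θ ∈ Y, ∃ lam : EuclideanSpace ℝ (Fin p), (∀ i, 0 ≤ lam i) ∧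
    v = lagr f g x y lam - ‖lam - z‖ ^ 2 / (2 * γ2)
        - lagr f g x θ z - ‖θ - y‖ ^ 2 / (2 * γ1) }

/-- global penalty result. If `F ≥ F̲` on `X × Y` and the truncated feasible set
contains a point with `G_γ = 0`, then for every `ε > 0` there is `c̄ > 0` such that for all
`c ≥ c̄`, every global minimizer of the penalized objective `F + c G_γ` over `X × Y × Z`
has `ε_c := G_γ(x_c,y_c,z_c) ≤ ε` and is a global minimizer of `F` over the `ε_c`-relaxed
feasible set. -/
theorem penalty_global {n m p : ℕ}
    (X : Set (EuclideanSpace ℝ (Fin n))) (Y : Set (EuclideanSpace ℝ (Fin m)))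
    (F : EuclideanSpace ℝ (Fin n) → EuclideanSpace ℝ (Fin m) → ℝ)
    (f : EuclideanSpace ℝ (Fin n) → EuclideanSpace ℝ (Fin m) → ℝ)
    (g : EuclideanSpace ℝ (Fin n) → EuclideanSpace ℝ (Fin m) → EuclideanSpace ℝ (Fin p))
    (γ1 γ2 r Flb : ℝ)
    (hXne : X.Nonempty) (hXcl : IsClosed X) (hXcv : Convex ℝ X)
    (hYne : Y.Nonempty) (hYcl : IsClosed Y) (hYcv : Convex ℝ Y)
    (hγ1 : 0 < γ1) (hγ2 : 0 < γ2) (hr : 0 ≤ r)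
    (hFlb : ∀ x ∈ X, ∀ y ∈ Y, Flb ≤ F x y)
    (hfeas : ∃ w : EuclideanSpace ℝ (Fin n) × EuclideanSpace ℝ (Fin m) ×
        EuclideanSpace ℝ (Fin p),
      w.1 ∈ X ∧ w.2.1 ∈ Y ∧ (∀ i, 0 ≤ w.2.2 i ∧ w.2.2 i ≤ r) ∧
      gapG f g Y γ1 γ2 w.1 w.2.1 w.2.2 = 0) :
    ∀ ε > (0 : ℝ), ∃ cbar > (0 : ℝ), ∀ c ≥ cbar,
      ∀ w : EuclideanSpace ℝ (Fin n) × EuclideanSpace ℝ (Fin m) × EuclideanSpace ℝ (Fin p),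
        w.1 ∈ X → w.2.1 ∈ Y → (∀ i, 0 ≤ w.2.2 i ∧ w.2.2 i ≤ r) →
        IsMinOn (fun w' : EuclideanSpace ℝ (Fin n) × EuclideanSpace ℝ (Fin m) ×
            EuclideanSpace ℝ (Fin p) =>
            F w'.1 w'.2.1 + c * gapG f g Y γ1 γ2 w'.1 w'.2.1 w'.2.2)
          { w' | w'.1 ∈ X ∧ w'.2.1 ∈ Y ∧ ∀ i, 0 ≤ w'.2.2 i ∧ w'.2.2 i ≤ r } w →
        gapG f g Y γ1 γ2 w.1 w.2.1 w.2.2 ≤ ε ∧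
        IsMinOn (fun w' : EuclideanSpace ℝ (Fin n) × EuclideanSpace ℝ (Fin m) ×
            EuclideanSpace ℝ (Fin p) => F w'.1 w'.2.1)
          { w' | w'.1 ∈ X ∧ w'.2.1 ∈ Y ∧ (∀ i, 0 ≤ w'.2.2 i ∧ w'.2.2 i ≤ r) ∧
              gapG f g Y γ1 γ2 w'.1 w'.2.1 w'.2.2 ≤ gapG f g Y γ1 γ2 w.1 w.2.1 w.2.2 } w := by
  obtain ⟨w₀, hx₀, hy₀, hz₀, hG₀⟩ := hfeas
  intro ε hε
  have hgap : 0 ≤ F w₀.1 w₀.2.1 - Flb := sub_nonneg.2 (hFlb _ hx₀ _ hy₀)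
  refine ⟨(F w₀.1 w₀.2.1 - Flb) / ε + 1, by positivity, ?_⟩
  intro c hc w hx hy hz hmin
  have hcpos : 0 < c := lt_of_lt_of_le (by positivity) hc
  rw [isMinOn_iff] at hmin
  constructor
  · have h := hmin w₀ ⟨hx₀, hy₀, hz₀⟩
    simp only [hG₀, mul_zero, add_zero] at h
    have hF := hFlb _ hx _ hy
    have hcε : F w₀.1 w₀.2.1 - Flb ≤ c * ε := (div_le_iff₀ hε).1 (by linarith)
    exact le_of_mul_le_mul_left (by linarith) hcpos
  · rw [isMinOn_iff]
    rintro w' ⟨hx', hy', hz', hG'⟩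
    have h := hmin w' ⟨hx', hy', hz'⟩
    have hcG := mul_le_mul_of_nonneg_left hG' hcpos.le
    linarith
end

section
/- Assume X and Y are closed, F, f and g are continuous on X × Y, for every x ∈ X the function f(x,·) and every gᵢ(x,·) are convex on Y (so that G_γ ≥ 0 on X × Y × Z), and the feasible set {(x,y,z) ∈ X × Y × Z : G_γ(x,y,z) ≤ 0} is nonempty. Let (c_k) be a sequence with c_k → ∞ and for each k let (x_k,y_k,z_k) be a global minimizer of (x,y,z) ↦ F(x,y) + c_k·G_γ(x,y,z) over X × Y × Z. Then every accumulation point (x̄,ȳ,z̄) of the sequence (x_k,y_k,z_k) is a global minimizer of (x,y,z) ↦ F(x,y) over {(x,y,z) ∈ X × Y × Z : G_γ(x,y,z) ≤ 0}. -/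
/-- A quadratic dominates a linear term: `a s - s² / (2γ) ≤ γ a² / 2`. -/
lemma mul_sub_sq_div_le {γ : ℝ} (hγ : 0 < γ) (a s : ℝ) :
    a * s - s ^ 2 / (2 * γ) ≤ γ * a ^ 2 / 2 := by
  have h : γ * a ^ 2 / 2 - (a * s - s ^ 2 / (2 * γ)) = (γ * a - s) ^ 2 / (2 * γ) := by
    field_simp
    ring
  have : 0 ≤ (γ * a - s) ^ 2 / (2 * γ) := by positivity
  linarith

/-- A continuous convex function on a closed set of a proper space decreases at most linearly. -/
lemma ConvexOn.exists_linear_lower_bound {E : Type*} [NormedAddCommGroup E] [NormedSpace ℝ E]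
    [ProperSpace E] {Y : Set E} (hY : IsClosed Y) {φ : E → ℝ} (hφ : ConvexOn ℝ Y φ)
    (hc : ContinuousOn φ Y) {y : E} (hy : y ∈ Y) :
    ∃ D : ℝ, ∀ θ ∈ Y, φ y - D - D * ‖θ - y‖ ≤ φ θ := by
  have hK : IsCompact (Y ∩ Metric.closedBall y 1) :=
    (isCompact_closedBall y 1).inter_left hY
  obtain ⟨q, hq, hmin⟩ := hK.exists_isMinOn ⟨y, hy, by simp⟩ (hc.mono Set.inter_subset_left)
  have hqy : φ q ≤ φ y := hmin (show y ∈ Y ∩ Metric.closedBall y 1 from ⟨hy, by simp⟩)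
  refine ⟨φ y - φ q, fun θ hθ => ?_⟩
  rcases le_total ‖θ - y‖ 1 with ht | ht
  · have h1 : φ q ≤ φ θ :=
      hmin (show θ ∈ Y ∩ Metric.closedBall y 1 from ⟨hθ, by simpa [dist_eq_norm] using ht⟩)
    have := mul_nonneg (sub_nonneg.2 hqy) (norm_nonneg (θ - y))
    linarith
  · set t := ‖θ - y‖ with htdef
    have ht0 : 0 < t := by linarith
    have hti : t⁻¹ ≤ 1 := inv_le_one_of_one_le₀ ht
    have hs : (1 - t⁻¹) + t⁻¹ = 1 := by ring
    have hmem := hφ.1 hy hθ (sub_nonneg.2 hti) (by positivity) hs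
    have hval := hφ.2 hy hθ (sub_nonneg.2 hti) (by positivity) hs
    have hball : (1 - t⁻¹) • y + t⁻¹ • θ ∈ Metric.closedBall y 1 := by
      have : (1 - t⁻¹) • y + t⁻¹ • θ - y = t⁻¹ • (θ - y) := by module
      rw [Metric.mem_closedBall, dist_eq_norm, this, norm_smul, ← htdef, Real.norm_eq_abs,
        abs_of_pos (by positivity), inv_mul_cancel₀ ht0.ne']
    have h1 : φ q ≤ (1 - t⁻¹) * φ y + t⁻¹ * φ θ :=
      (hmin (show _ ∈ Y ∩ Metric.closedBall y 1 from ⟨hmem, hball⟩)).trans hval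
    have h2 := mul_le_mul_of_nonneg_left h1 ht0.le
    have h3 : t * ((1 - t⁻¹) * φ y + t⁻¹ * φ θ) = (t - 1) * φ y + φ θ := by
      field_simp
    nlinarith

/-- The Lagrangian is bounded above in the multiplier after quadratic regularization. -/
lemma lagr_sub_sq_le {n m p : ℕ}
    (f : EuclideanSpace ℝ (Fin n) → EuclideanSpace ℝ (Fin m) → ℝ)
    (g : EuclideanSpace ℝ (Fin n) → EuclideanSpace ℝ (Fin m) → EuclideanSpace ℝ (Fin p))
    {γ : ℝ} (hγ : 0 < γ) (x : EuclideanSpace ℝ (Fin n)) (y : EuclideanSpace ℝ (Fin m))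
    (z lam : EuclideanSpace ℝ (Fin p)) :
    lagr f g x y lam - ‖lam - z‖ ^ 2 / (2 * γ) ≤
      lagr f g x y z + ∑ i, γ * g x y i ^ 2 / 2 := by
  have h : ∑ i, (g x y i * (lam i - z i) - (lam i - z i) ^ 2 / (2 * γ)) ≤
      ∑ i, γ * g x y i ^ 2 / 2 :=
    Finset.sum_le_sum fun i _ => mul_sub_sq_div_le hγ _ _
  have h2 : ∑ i, g x y i * (lam i - z i) = ∑ i, lam i * g x y i - ∑ i, z i * g x y i := by
    rw [← Finset.sum_sub_distrib]
    exact Finset.sum_congr rfl fun i _ => by ring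
  rw [Finset.sum_sub_distrib, h2, ← Finset.sum_div] at h
  simp only [lagr, EuclideanSpace.real_norm_sq_eq, PiLp.sub_apply]
  linarith

/-- The regularized values defining the gap function are bounded above. -/
lemma bddAbove_gapG {n m p : ℕ}
    {f : EuclideanSpace ℝ (Fin n) → EuclideanSpace ℝ (Fin m) → ℝ}
    {g : EuclideanSpace ℝ (Fin n) → EuclideanSpace ℝ (Fin m) → EuclideanSpace ℝ (Fin p)}
    {Y : Set (EuclideanSpace ℝ (Fin m))} {γ1 γ2 : ℝ} (hγ1 : 0 < γ1) (hγ2 : 0 < γ2)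
    (hY : IsClosed Y) {x : EuclideanSpace ℝ (Fin n)} {y : EuclideanSpace ℝ (Fin m)}
    {z : EuclideanSpace ℝ (Fin p)} (hy : y ∈ Y)
    (hcv : ConvexOn ℝ Y fun θ => lagr f g x θ z)
    (hcont : ContinuousOn (fun θ => lagr f g x θ z) Y) :
    BddAbove { v : ℝ | ∃ θ ∈ Y, ∃ lam : EuclideanSpace ℝ (Fin p), (∀ i, 0 ≤ lam i) ∧
      v = lagr f g x y lam - ‖lam - z‖ ^ 2 / (2 * γ2)
        - lagr f g x θ z - ‖θ - y‖ ^ 2 / (2 * γ1) } := by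
  obtain ⟨D, hD⟩ := hcv.exists_linear_lower_bound hY hcont hy
  refine ⟨∑ i, γ2 * g x y i ^ 2 / 2 + D + γ1 * D ^ 2 / 2, ?_⟩
  rintro v ⟨θ, hθ, lam, -, rfl⟩
  have h1 := lagr_sub_sq_le f g hγ2 x y z lam
  have h2 := hD θ hθ
  have h3 := mul_sub_sq_div_le hγ1 D ‖θ - y‖
  linarith

/-- The gap function is nonnegative at dual-feasible points. -/
lemma gapG_nonneg {n m p : ℕ}
    (f : EuclideanSpace ℝ (Fin n) → EuclideanSpace ℝ (Fin m) → ℝ)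
    (g : EuclideanSpace ℝ (Fin n) → EuclideanSpace ℝ (Fin m) → EuclideanSpace ℝ (Fin p))
    {Y : Set (EuclideanSpace ℝ (Fin m))} (γ1 γ2 : ℝ) (x : EuclideanSpace ℝ (Fin n))
    {y : EuclideanSpace ℝ (Fin m)} {z : EuclideanSpace ℝ (Fin p)} (hy : y ∈ Y)
    (hz : ∀ i, 0 ≤ z i) : 0 ≤ gapG f g Y γ1 γ2 x y z :=
  Real.sSup_nonneg' ⟨0, ⟨y, hy, z, hz, by simp⟩, le_rfl⟩

/-- accumulation points of minimizers of the penalized problems with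
`c_k → ∞` are minimizers of `F` over the truncated feasible set. -/
theorem penalty_accumulation {n m p : ℕ}
    (X : Set (EuclideanSpace ℝ (Fin n))) (Y : Set (EuclideanSpace ℝ (Fin m)))
    (F : EuclideanSpace ℝ (Fin n) → EuclideanSpace ℝ (Fin m) → ℝ)
    (f : EuclideanSpace ℝ (Fin n) → EuclideanSpace ℝ (Fin m) → ℝ)
    (g : EuclideanSpace ℝ (Fin n) → EuclideanSpace ℝ (Fin m) → EuclideanSpace ℝ (Fin p))
    (γ1 γ2 r : ℝ)
    (hXne : X.Nonempty) (hXcl : IsClosed X) (hXcv : Convex ℝ X)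
    (hYne : Y.Nonempty) (hYcl : IsClosed Y) (hYcv : Convex ℝ Y)
    (hγ1 : 0 < γ1) (hγ2 : 0 < γ2) (hr : 0 ≤ r)
    (hFcont : ContinuousOn (fun q : EuclideanSpace ℝ (Fin n) × EuclideanSpace ℝ (Fin m) =>
      F q.1 q.2) (X ×ˢ Y))
    (hfcont : ContinuousOn (fun q : EuclideanSpace ℝ (Fin n) × EuclideanSpace ℝ (Fin m) =>
      f q.1 q.2) (X ×ˢ Y))
    (hgcont : ∀ i, ContinuousOn
      (fun q : EuclideanSpace ℝ (Fin n) × EuclideanSpace ℝ (Fin m) => g q.1 q.2 i) (X ×ˢ Y))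
    (hfcv : ∀ x ∈ X, ConvexOn ℝ Y (fun y => f x y))
    (hgcv : ∀ x ∈ X, ∀ i, ConvexOn ℝ Y (fun y => g x y i))
    (hfeas : ∃ w : EuclideanSpace ℝ (Fin n) × EuclideanSpace ℝ (Fin m) ×
        EuclideanSpace ℝ (Fin p),
      w.1 ∈ X ∧ w.2.1 ∈ Y ∧ (∀ i, 0 ≤ w.2.2 i ∧ w.2.2 i ≤ r) ∧
      gapG f g Y γ1 γ2 w.1 w.2.1 w.2.2 ≤ 0)
    (c : ℕ → ℝ) (hc : Filter.Tendsto c Filter.atTop Filter.atTop)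
    (w : ℕ → EuclideanSpace ℝ (Fin n) × EuclideanSpace ℝ (Fin m) × EuclideanSpace ℝ (Fin p))
    (hwmem : ∀ k, (w k).1 ∈ X ∧ (w k).2.1 ∈ Y ∧ ∀ i, 0 ≤ (w k).2.2 i ∧ (w k).2.2 i ≤ r)
    (hwmin : ∀ k, IsMinOn (fun w' : EuclideanSpace ℝ (Fin n) × EuclideanSpace ℝ (Fin m) ×
        EuclideanSpace ℝ (Fin p) =>
        F w'.1 w'.2.1 + c k * gapG f g Y γ1 γ2 w'.1 w'.2.1 w'.2.2)
      { w' | w'.1 ∈ X ∧ w'.2.1 ∈ Y ∧ ∀ i, 0 ≤ w'.2.2 i ∧ w'.2.2 i ≤ r } (w k))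
    (wbar : EuclideanSpace ℝ (Fin n) × EuclideanSpace ℝ (Fin m) × EuclideanSpace ℝ (Fin p))
    (hacc : MapClusterPt wbar Filter.atTop w) :
    wbar.1 ∈ X ∧ wbar.2.1 ∈ Y ∧ (∀ i, 0 ≤ wbar.2.2 i ∧ wbar.2.2 i ≤ r) ∧
    gapG f g Y γ1 γ2 wbar.1 wbar.2.1 wbar.2.2 ≤ 0 ∧
    IsMinOn (fun w' : EuclideanSpace ℝ (Fin n) × EuclideanSpace ℝ (Fin m) ×
        EuclideanSpace ℝ (Fin p) => F w'.1 w'.2.1)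
      { w' | w'.1 ∈ X ∧ w'.2.1 ∈ Y ∧ (∀ i, 0 ≤ w'.2.2 i ∧ w'.2.2 i ≤ r) ∧
          gapG f g Y γ1 γ2 w'.1 w'.2.1 w'.2.2 ≤ 0 } wbar := by
  have hZcl : ∀ i, IsClosed {q : EuclideanSpace ℝ (Fin p) | 0 ≤ q i ∧ q i ≤ r} := fun i =>
    (isClosed_Icc (a := 0) (b := r)).preimage
      (by fun_prop : Continuous fun q : EuclideanSpace ℝ (Fin p) => q i)
  obtain ⟨U, hU, hw⟩ := mapClusterPt_iff_ultrafilter.1 hacc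
  have hcU : Filter.Tendsto c U Filter.atTop := hc.mono_left hU
  have hw1 : Filter.Tendsto (fun k => (w k).1) U (nhds wbar.1) := hw.fst_nhds
  have hw2 : Filter.Tendsto (fun k => (w k).2.1) U (nhds wbar.2.1) := hw.snd_nhds.fst_nhds
  have hw3 : Filter.Tendsto (fun k => (w k).2.2) U (nhds wbar.2.2) := hw.snd_nhds.snd_nhds
  have hX : wbar.1 ∈ X := hXcl.mem_of_tendsto hw1 (.of_forall fun k => (hwmem k).1)
  have hY : wbar.2.1 ∈ Y := hYcl.mem_of_tendsto hw2 (.of_forall fun k => (hwmem k).2.1)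
  have hZ : ∀ i, 0 ≤ wbar.2.2 i ∧ wbar.2.2 i ≤ r := fun i =>
    (hZcl i).mem_of_tendsto hw3 (.of_forall fun k => (hwmem k).2.2 i)
  have hlim : ∀ {h : EuclideanSpace ℝ (Fin n) → EuclideanSpace ℝ (Fin m) → ℝ},
      ContinuousOn (fun q : EuclideanSpace ℝ (Fin n) × EuclideanSpace ℝ (Fin m) =>
        h q.1 q.2) (X ×ˢ Y) → ∀ {y : ℕ → EuclideanSpace ℝ (Fin m)} {y' : _},
      (∀ k, y k ∈ Y) → y' ∈ Y → Filter.Tendsto y U (nhds y') →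
      Filter.Tendsto (fun k => h (w k).1 (y k)) U (nhds (h wbar.1 y')) := by
    intro h hh y y' hy hy' hyt
    exact (hh (wbar.1, y') ⟨hX, hy'⟩).tendsto.comp
      (tendsto_nhdsWithin_iff.2
        ⟨hw1.prodMk_nhds hyt, .of_forall fun k => ⟨(hwmem k).1, hy k⟩⟩)
  have hlagr : ∀ {y : ℕ → EuclideanSpace ℝ (Fin m)} {y' : EuclideanSpace ℝ (Fin m)}
      {z : ℕ → EuclideanSpace ℝ (Fin p)} {z' : EuclideanSpace ℝ (Fin p)},
      (∀ k, y k ∈ Y) → y' ∈ Y → Filter.Tendsto y U (nhds y') → Filter.Tendsto z U (nhds z') →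
      Filter.Tendsto (fun k => lagr f g (w k).1 (y k) (z k)) U
        (nhds (lagr f g wbar.1 y' z')) := by
    intro y y' z z' hy hy' hyt hzt
    refine (hlim hfcont hy hy' hyt).add (tendsto_finsetSum _ fun i _ => ?_)
    exact (((by fun_prop : Continuous fun q : EuclideanSpace ℝ (Fin p) => q i).tendsto
      z').comp hzt).mul (hlim (h := fun x y => g x y i) (hgcont i) hy hy' hyt)
  have hF := hlim hFcont (fun k => (hwmem k).2.1) hY hw2
  have hbdd : ∀ k, BddAbove { v : ℝ | ∃ θ ∈ Y, ∃ lam : EuclideanSpace ℝ (Fin p),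
      (∀ i, 0 ≤ lam i) ∧ v = lagr f g (w k).1 (w k).2.1 lam - ‖lam - (w k).2.2‖ ^ 2 / (2 * γ2)
        - lagr f g (w k).1 θ (w k).2.2 - ‖θ - (w k).2.1‖ ^ 2 / (2 * γ1) } := by
    intro k
    have hsec : Set.MapsTo (fun θ => ((w k).1, θ)) Y (X ×ˢ Y) := fun θ hθ => ⟨(hwmem k).1, hθ⟩
    have hpair : ContinuousOn (fun θ : EuclideanSpace ℝ (Fin m) => ((w k).1, θ)) Y := by fun_prop
    refine bddAbove_gapG hγ1 hγ2 hYcl (hwmem k).2.1 ?_ ?_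
    · refine (hfcv _ (hwmem k).1).add ?_
      have hsum : ∀ s : Finset (Fin p), ConvexOn ℝ Y
          fun θ => ∑ i ∈ s, (w k).2.2 i * g (w k).1 θ i := by
        intro s
        induction s using Finset.cons_induction with
        | empty => simpa using convexOn_const (0 : ℝ) hYcv
        | cons a s ha ih =>
          simp only [Finset.sum_cons]
          exact ((hgcv _ (hwmem k).1 a).smul ((hwmem k).2.2 a).1).add ih
      exact hsum Finset.univ
    · exact (hfcont.comp hpair hsec).add (continuousOn_finsetSum _ fun i _ =>
        continuousOn_const.mul ((hgcont i).comp hpair hsec))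
  have hpen : ∀ w' : EuclideanSpace ℝ (Fin n) × EuclideanSpace ℝ (Fin m) ×
        EuclideanSpace ℝ (Fin p), w'.1 ∈ X → w'.2.1 ∈ Y → (∀ i, 0 ≤ w'.2.2 i ∧ w'.2.2 i ≤ r) →
      gapG f g Y γ1 γ2 w'.1 w'.2.1 w'.2.2 ≤ 0 → ∀ k, 0 < c k →
      F (w k).1 (w k).2.1 + c k * gapG f g Y γ1 γ2 (w k).1 (w k).2.1 (w k).2.2 ≤
        F w'.1 w'.2.1 := by
    intro w' h1 h2 h3 h4 k hk
    have h := hwmin k (show w' ∈ { w' | w'.1 ∈ X ∧ w'.2.1 ∈ Y ∧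
      ∀ i, 0 ≤ w'.2.2 i ∧ w'.2.2 i ≤ r } from ⟨h1, h2, h3⟩)
    have h5 := mul_nonpos_of_nonneg_of_nonpos hk.le h4
    simp only [Set.mem_ofPred_eq] at h
    linarith
  refine ⟨hX, hY, hZ, ?_, ?_⟩
  · obtain ⟨v, hv1, hv2, hv3, hv4⟩ := hfeas
    have hup : Filter.Tendsto (fun k => (F v.1 v.2.1 - F (w k).1 (w k).2.1) / c k) U (nhds 0) :=
      (tendsto_const_nhds.sub hF).div_atTop hcU
    refine Real.sSup_le ?_ le_rfl
    rintro _ ⟨θ, hθ, lam, hlam, rfl⟩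
    have hval := (((hlagr (fun k => (hwmem k).2.1) hY hw2 (tendsto_const_nhds (x := lam))).sub
      (((tendsto_const_nhds (x := lam)).sub hw3).norm.pow 2 |>.div_const (2 * γ2))).sub
      (hlagr (fun _ => hθ) hθ tendsto_const_nhds hw3)).sub
      (((tendsto_const_nhds (x := θ)).sub hw2).norm.pow 2 |>.div_const (2 * γ1))
    refine le_of_tendsto_of_tendsto hval hup ?_
    filter_upwards [hcU.eventually_gt_atTop 0] with k hk
    refine (le_csSup (hbdd k) ⟨θ, hθ, lam, hlam, rfl⟩).trans ?_
    rw [le_div_iff₀ hk]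
    have h := hpen v hv1 hv2 hv3 hv4 k hk
    rw [gapG] at h
    linarith
  · rintro v ⟨hv1, hv2, hv3, hv4⟩
    refine le_of_tendsto hF ?_
    filter_upwards [hcU.eventually_gt_atTop 0] with k hk
    have h := hpen v hv1 hv2 hv3 hv4 k hk
    have := mul_nonneg hk.le (gapG_nonneg f g γ1 γ2 (w k).1 (hwmem k).2.1
      fun i => ((hwmem k).2.2 i).1)
    linarith
end

section
/- Assume f(x,y,z) is convex in y on Y for each fixed (x,z) ∈ X × Z and concave in z on Z for each fixed (x,y) ∈ X × Y. Then for any γ₁, γ₂ > 0: the saddle-point gap function satisfies G^saddle_γ(x,y,z) ≥ 0 for every (x,y,z) ∈ X × Y × Z, and G^saddle_γ(x,y,z) ≤ 0 if and only if (y,z) is a saddle point of f(x,·,·) on Y × Z, i.e. f(x,y,z') ≤ f(x,y,z) ≤ f(x,y',z) for all y' ∈ Y and z' ∈ Z. -/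
/-- The doubly regularized gap function for a minimax lower-level problem:
`G^saddle_γ(x,y,z) = sup_{θ ∈ Y, λ ∈ Z} [f(x,y,λ) − ‖λ−z‖²/(2γ₂) − f(x,θ,z) − ‖θ−y‖²/(2γ₁)]`. -/
noncomputable def gapSaddle {n m p : ℕ}
    (f : EuclideanSpace ℝ (Fin n) → EuclideanSpace ℝ (Fin m) → EuclideanSpace ℝ (Fin p) → ℝ)
    (Y : Set (EuclideanSpace ℝ (Fin m))) (Z : Set (EuclideanSpace ℝ (Fin p)))
    (γ1 γ2 : ℝ) (x : EuclideanSpace ℝ (Fin n)) (y : EuclideanSpace ℝ (Fin m))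
    (z : EuclideanSpace ℝ (Fin p)) : ℝ :=
  sSup { v : ℝ | ∃ θ ∈ Y, ∃ lam ∈ Z,
    v = f x y lam - ‖lam - z‖ ^ 2 / (2 * γ2) - f x θ z - ‖θ - y‖ ^ 2 / (2 * γ1) }

/-- A convex function on a set, continuous at a point of it, is bounded below there once a
positive multiple of the squared distance to that point is added. -/
theorem ConvexOn.exists_le_add_sq_norm_div {E : Type*} [NormedAddCommGroup E] [NormedSpace ℝ E]
    {S : Set E} {g : E → ℝ} (hg : ConvexOn ℝ S g) {w₀ : E} (hw₀ : w₀ ∈ S)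
    (hc : ContinuousWithinAt g S w₀) {γ : ℝ} (hγ : 0 < γ) :
    ∃ C : ℝ, ∀ w ∈ S, C ≤ g w + ‖w - w₀‖ ^ 2 / (2 * γ) := by
  obtain ⟨δ, hδ, hball⟩ := Metric.continuousWithinAt_iff.1 hc 1 one_pos
  obtain ⟨r, hr, hrδ⟩ := exists_between hδ
  refine ⟨g w₀ - 1 - γ / (2 * r ^ 2), fun w hw => ?_⟩
  have hsq : 0 ≤ ‖w - w₀‖ ^ 2 / (2 * γ) := by positivity
  have hγr : 0 ≤ γ / (2 * r ^ 2) := by positivity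
  rcases lt_or_ge ‖w - w₀‖ δ with h | h
  · have := hball hw (by rwa [dist_eq_norm])
    rw [Real.dist_eq, abs_lt] at this
    linarith
  · have hs : 0 < ‖w - w₀‖ := hδ.trans_le h
    set t := r / ‖w - w₀‖ with ht
    have ht0 : 0 < t := by positivity
    have ht1 : t ≤ 1 := (div_le_one hs).2 (by linarith)
    have hmem : (1 - t) • w₀ + t • w ∈ S := hg.1 hw₀ hw (by linarith) ht0.le (by ring)
    have hconv := hg.2 hw₀ hw (by linarith : 0 ≤ 1 - t) ht0.le (by ring)
    have hdist : dist ((1 - t) • w₀ + t • w) w₀ < δ := by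
      rw [dist_eq_norm, show (1 - t) • w₀ + t • w - w₀ = t • (w - w₀) by module, norm_smul,
        Real.norm_of_nonneg ht0.le, ht, div_mul_cancel₀ _ hs.ne']
      exact hrδ
    have hnear := hball hmem hdist
    rw [Real.dist_eq, abs_lt] at hnear
    simp only [smul_eq_mul] at hconv
    have hmul : -1 ≤ t * (g w - g w₀) := by linarith
    have hlin : -(‖w - w₀‖ / r) ≤ g w - g w₀ := by
      have := (div_le_iff₀' ht0).2 hmul
      rwa [ht, neg_div, one_div_div] at this
    have hquad : ‖w - w₀‖ / r ≤ ‖w - w₀‖ ^ 2 / (2 * γ) + γ / (2 * r ^ 2) := by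
      have : ‖w - w₀‖ ^ 2 / (2 * γ) + γ / (2 * r ^ 2) - ‖w - w₀‖ / r
          = (r * ‖w - w₀‖ - γ) ^ 2 / (2 * γ * r ^ 2) := by
        field_simp
        ring
      have : 0 ≤ (r * ‖w - w₀‖ - γ) ^ 2 / (2 * γ * r ^ 2) := by positivity
      linarith
    linarith

/-- A fixed point of the proximal step of a convex function is a minimizer. -/
theorem ConvexOn.isMinOn_of_le_add_sq_norm_div {E : Type*} [NormedAddCommGroup E]
    [NormedSpace ℝ E] {S : Set E} {g : E → ℝ} (hg : ConvexOn ℝ S g) {w₀ : E} (hw₀ : w₀ ∈ S)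
    {γ : ℝ} (hγ : 0 < γ) (h : ∀ w ∈ S, g w₀ ≤ g w + ‖w - w₀‖ ^ 2 / (2 * γ)) :
    IsMinOn g S w₀ := by
  refine isMinOn_iff.2 fun w hw => ?_
  by_contra! hlt
  have hd : 0 < g w₀ - g w := sub_pos.2 hlt
  set N := ‖w - w₀‖ ^ 2 / (2 * γ) with hN
  have hN0 : 0 ≤ N := by positivity
  set t := (g w₀ - g w) / (g w₀ - g w + N) with ht
  have ht0 : 0 < t := by positivity
  have ht1 : t ≤ 1 := (div_le_one (by positivity)).2 (by linarith)
  have hmem : (1 - t) • w₀ + t • w ∈ S := hg.1 hw₀ hw (by linarith) ht0.le (by ring)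
  have hconv := hg.2 hw₀ hw (by linarith : 0 ≤ 1 - t) ht0.le (by ring)
  have hstep := h _ hmem
  rw [show (1 - t) • w₀ + t • w - w₀ = t • (w - w₀) by module, norm_smul, mul_pow,
    Real.norm_of_nonneg ht0.le, mul_div_assoc, ← hN] at hstep
  simp only [smul_eq_mul] at hconv
  have hle : g w₀ - g w ≤ t * N := by
    refine le_of_mul_le_mul_left ?_ ht0
    linarith
  have hteq : t * (g w₀ - g w + N) = g w₀ - g w := div_mul_cancel₀ _ (by positivity)
  linarith [mul_pos ht0 hd]

/-- the saddle gap function is nonnegative on `X × Y × Z`, and nonpositive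
exactly at the saddle points of `f(x,·,·)` on `Y × Z`. -/
theorem gapSaddle_nonneg_and_zero_iff_saddle {n m p : ℕ}
    (X : Set (EuclideanSpace ℝ (Fin n))) (Y : Set (EuclideanSpace ℝ (Fin m)))
    (Z : Set (EuclideanSpace ℝ (Fin p)))
    (f : EuclideanSpace ℝ (Fin n) → EuclideanSpace ℝ (Fin m) → EuclideanSpace ℝ (Fin p) → ℝ)
    (γ1 γ2 : ℝ)
    (hXne : X.Nonempty) (hXcl : IsClosed X) (hXcv : Convex ℝ X)
    (hYne : Y.Nonempty) (hYcl : IsClosed Y) (hYcv : Convex ℝ Y)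
    (hZne : Z.Nonempty) (hZcl : IsClosed Z) (hZcv : Convex ℝ Z)
    (hγ1 : 0 < γ1) (hγ2 : 0 < γ2)
    (hfC1 : ∃ U, IsOpen U ∧ X ×ˢ Y ×ˢ Z ⊆ U ∧
      ContDiffOn ℝ 1 (fun q : EuclideanSpace ℝ (Fin n) × EuclideanSpace ℝ (Fin m) ×
        EuclideanSpace ℝ (Fin p) => f q.1 q.2.1 q.2.2) U)
    (hfcv : ∀ x ∈ X, ∀ z ∈ Z, ConvexOn ℝ Y (fun y => f x y z))
    (hfcc : ∀ x ∈ X, ∀ y ∈ Y, ConcaveOn ℝ Z (fun z => f x y z)) :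
    ∀ x ∈ X, ∀ y ∈ Y, ∀ z ∈ Z,
      0 ≤ gapSaddle f Y Z γ1 γ2 x y z ∧
      (gapSaddle f Y Z γ1 γ2 x y z ≤ 0 ↔
        (∀ z' ∈ Z, f x y z' ≤ f x y z) ∧ (∀ y' ∈ Y, f x y z ≤ f x y' z)) := by
  intro x hx y hy z hz
  obtain ⟨U, hU, hsub, hf⟩ := hfC1
  have hcont : ContinuousAt (fun q : EuclideanSpace ℝ (Fin n) × EuclideanSpace ℝ (Fin m) ×
      EuclideanSpace ℝ (Fin p) => f q.1 q.2.1 q.2.2) (x, y, z) :=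
    hf.continuousOn.continuousAt (hU.mem_nhds (hsub ⟨hx, hy, hz⟩))
  have hcy : ContinuousAt (fun θ => f x θ z) y :=
    hcont.comp (f := fun θ => (x, θ, z)) (by fun_prop)
  have hcz : ContinuousAt (fun lam => f x y lam) z :=
    hcont.comp (f := fun lam => (x, y, lam)) (by fun_prop)
  have hvy := hfcv x hx z hz
  have hvz : ConvexOn ℝ Z (fun lam => -f x y lam) := (hfcc x hx y hy).neg
  obtain ⟨A, hA⟩ := hvy.exists_le_add_sq_norm_div hy hcy.continuousWithinAt hγ1
  obtain ⟨B, hB⟩ := hvz.exists_le_add_sq_norm_div hz hcz.neg.continuousWithinAt hγ2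
  have hbdd : BddAbove { v : ℝ | ∃ θ ∈ Y, ∃ lam ∈ Z,
      v = f x y lam - ‖lam - z‖ ^ 2 / (2 * γ2) - f x θ z - ‖θ - y‖ ^ 2 / (2 * γ1) } := by
    refine ⟨-A - B, ?_⟩
    rintro _ ⟨θ, hθ, lam, hlam, rfl⟩
    linarith [hA θ hθ, hB lam hlam]
  have hle : ∀ θ ∈ Y, ∀ lam ∈ Z, f x y lam - ‖lam - z‖ ^ 2 / (2 * γ2) - f x θ z
      - ‖θ - y‖ ^ 2 / (2 * γ1) ≤ gapSaddle f Y Z γ1 γ2 x y z :=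
    fun θ hθ lam hlam => le_csSup hbdd ⟨θ, hθ, lam, hlam, rfl⟩
  refine ⟨by simpa using hle y hy z hz, fun hgap => ⟨fun z' hz' => ?_, ?_⟩, ?_⟩
  · refine neg_le_neg_iff.1 (isMinOn_iff.1
      (hvz.isMinOn_of_le_add_sq_norm_div hz hγ2 fun lam hlam => ?_) z' hz')
    have := hle y hy lam hlam
    simp only [sub_self, norm_zero, ne_eq, OfNat.ofNat_ne_zero, not_false_eq_true, zero_pow,
      zero_div] at this
    linarith
  · refine isMinOn_iff.1 (hvy.isMinOn_of_le_add_sq_norm_div hy hγ1 fun θ hθ => ?_)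
    have := hle θ hθ z hz
    simp only [sub_self, norm_zero, ne_eq, OfNat.ofNat_ne_zero, not_false_eq_true, zero_pow,
      zero_div] at this
    linarith
  · rintro ⟨hmax, hmin⟩
    refine Real.sSup_nonpos ?_
    rintro _ ⟨θ, hθ, lam, hlam, rfl⟩
    have h₁ : 0 ≤ ‖θ - y‖ ^ 2 / (2 * γ1) := by positivity
    have h₂ : 0 ≤ ‖lam - z‖ ^ 2 / (2 * γ2) := by positivity
    linarith [hmax lam hlam, hmin θ hθ]
end
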